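/- Let EP be a minimum-order non-4-colorable maximal planar graph with more than 4 vertices, e = ab an edge of EP whose two incident triangular faces are abN and abS. Then N and S are not adjacent in EP. -/

import Mathlib

open SimpleGraph

/-- A simple graph is planar if it admits a straight-line drawing in the plane
(by Fáry's theorem this is equivalent to topological planarity for simple graphs):
an injective placement of the vertices such that two distinct edges, drawn as
closed segments, meet only in common endpoints. -/
def IsPlanar {V : Type} (G : SimpleGraph V) : Prop :=
  ∃ pos : V → ℝ × ℝ, Function.Injective pos ∧
    ∀ u v x y : V, G.Adj u v → G.Adj x y → s(u, v) ≠ s(x, y) →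
      ∀ p : ℝ × ℝ, p ∈ segment ℝ (pos u) (pos v) → p ∈ segment ℝ (pos x) (pos y) →
        (p = pos u ∨ p = pos v) ∧ (p = pos x ∨ p = pos y)

/-- A maximal planar graph (planar triangulation): planar, and no edge between
two non-adjacent vertices can be added while preserving planarity. -/
def IsMaximalPlanar {V : Type} [Fintype V] (G : SimpleGraph V) : Prop :=
  IsPlanar G ∧ ∀ u v : V, u ≠ v → ¬ G.Adj u v →
    ¬ IsPlanar (G ⊔ SimpleGraph.fromEdgeSet {s(u, v)})

/-- A minimum-order counterexample to the Four Color Theorem: a maximal planar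
graph that is not 4-colorable, of minimum number of vertices among all such graphs. -/
def IsMinCounterexample {V : Type} [Fintype V] (G : SimpleGraph V) : Prop :=
  IsMaximalPlanar G ∧ ¬ G.Colorable 4 ∧
    ∀ (W : Type) [Fintype W] (H : SimpleGraph W),
      IsMaximalPlanar H → ¬ H.Colorable 4 → Fintype.card V ≤ Fintype.card W

theorem exists_perm_aux (i : Fin 4) (g : Fin 4 → Fin 4)
    (hg : ∀ j k, j ≠ i → k ≠ i → j ≠ k → g j ≠ g k) :
    ∃ σ : Equiv.Perm (Fin 4), ∀ j, j ≠ i → σ (g j) = j := by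
  classical
  let e : {j // j ≠ i} ≃ {y // y ∈ Set.range (fun j : {j // j ≠ i} => g j)} :=
    Equiv.ofInjective (fun j : {j // j ≠ i} => g j) (by
      intro a b hab
      by_contra hne
      exact hg a b a.2 b.2 (fun h => hne (Subtype.ext h)) hab)
  refine ⟨(e.extendSubtype).symm, fun j hj => ?_⟩
  rw [Equiv.symm_apply_eq, Equiv.extendSubtype_apply_of_mem e j hj]
  rfl

theorem combine_aux {V : Type} (G : SimpleGraph V)
    (hsub : ∀ x : V, (G.induce {v | v ≠ x}).Colorable 4)
    (K : Fin 4 → V) (hK : ∀ i j, i ≠ j → G.Adj (K i) (K j)) (r : V → Fin 4)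
    (h1 : ∀ v w, (∀ j, v ≠ K j) → (∀ j, w ≠ K j) → G.Adj v w → r v = r w)
    (h2 : ∀ v j, (∀ j, v ≠ K j) → G.Adj v (K j) → r v ≠ j) : G.Colorable 4 := by
  classical
  have key : ∀ i, ∃ c : V → Fin 4, (∀ v w, v ≠ K i → w ≠ K i → G.Adj v w → c v ≠ c w) ∧
      ∀ j, j ≠ i → c (K j) = j := by
    intro i
    obtain ⟨c⟩ := hsub (K i)
    let d : V → Fin 4 := fun v => if h : v ≠ K i then c ⟨v, h⟩ else 0
    have hd : ∀ v w, v ≠ K i → w ≠ K i → G.Adj v w → d v ≠ d w := by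
      intro v w hv hw hvw
      simp only [d, dif_pos hv, dif_pos hw]
      exact c.valid (v := ⟨v, hv⟩) (w := ⟨w, hw⟩) hvw
    obtain ⟨σ, hσ⟩ := exists_perm_aux i (fun j => d (K j)) (by
      intro j k hj hk hjk
      exact hd _ _ (hK j i hj).ne (hK k i hk).ne (hK j k hjk))
    refine ⟨fun v => σ (d v), fun v w hv hw hvw h => hd v w hv hw hvw (σ.injective h), hσ⟩
  choose c hc1 hc2 using key
  have hinj : ∀ i j, K i = K j → i = j := by
    intro i j h
    by_contra hne
    exact (hK i j hne).ne h
  let f : V → Fin 4 := fun v => if h : ∃ j, v = K j then h.choose else c (r v) v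
  have fK : ∀ j, f (K j) = j := by
    intro j
    have h : ∃ k, K j = K k := ⟨j, rfl⟩
    simp only [f, dif_pos h]
    exact (hinj _ _ h.choose_spec).symm
  have fn : ∀ v, (∀ j, v ≠ K j) → f v = c (r v) v := by
    intro v hv
    have h : ¬ ∃ k, v = K k := by push Not; exact hv
    simp only [f, dif_neg h]
  have mixed : ∀ v j, (∀ j, v ≠ K j) → G.Adj v (K j) → f v ≠ f (K j) := by
    intro v j hv hvj
    have hr := h2 v j hv hvj
    rw [fn v hv, fK, ← hc2 (r v) j hr.symm]
    exact hc1 _ _ _ (hv _) (hK _ _ hr.symm).ne hvj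
  refine ⟨Coloring.mk f ?_⟩
  intro v w hvw
  by_cases hv : ∃ j, v = K j
  · obtain ⟨j, rfl⟩ := hv
    by_cases hw : ∃ j, w = K j
    · obtain ⟨k, rfl⟩ := hw
      rw [fK, fK]
      rintro rfl
      exact hvw.ne rfl
    · push Not at hw
      exact (mixed w j hw hvw.symm).symm
  · push Not at hv
    by_cases hw : ∃ j, w = K j
    · obtain ⟨k, rfl⟩ := hw
      exact mixed v k hv hvw
    · push Not at hw
      rw [fn v hv, fn w hw, ← h1 v w hv hw hvw]
      exact hc1 _ _ _ (hv _) (hw _) hvw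

theorem planar_induce {V : Type} (G : SimpleGraph V) (s : Set V) (h : IsPlanar G) :
    IsPlanar (G.induce s) := by
  obtain ⟨pos, hinj, hp⟩ := h
  refine ⟨fun v => pos v, fun a b hab => Subtype.ext (hinj hab), ?_⟩
  intro u v x y huv hxy hne p h1 h2
  refine hp u v x y huv hxy ?_ p h1 h2
  intro h
  apply hne
  simp only [Sym2.eq_iff] at h ⊢
  simpa [Subtype.ext_iff] using h

theorem exists_maximal {V : Type} [Fintype V] (G : SimpleGraph V) (h : IsPlanar G) :
    ∃ H : SimpleGraph V, G ≤ H ∧ IsMaximalPlanar H := by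
  classical
  obtain ⟨H, hGH, hH⟩ := (Set.toFinite {H : SimpleGraph V | IsPlanar H}).exists_le_maximal
    (a := G) h
  refine ⟨H, hGH, hH.1, ?_⟩
  intro u v huv hn hp
  have := hH.2 hp le_sup_left
  apply hn
  apply this
  right
  simp [huv]

theorem sub_colorable {V : Type} [Fintype V] (G : SimpleGraph V) (h : IsMinCounterexample G)
    (x : V) : (G.induce {v | v ≠ x}).Colorable 4 := by
  classical
  obtain ⟨H, hle, hH⟩ := exists_maximal _ (planar_induce G {v | v ≠ x} h.1.1)
  by_contra hc
  have := h.2.2 _ H hH (fun hcol => hc (hcol.mono_left hle))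
  have h2 : Fintype.card {v : V // v ≠ x} < Fintype.card V :=
    Fintype.card_subtype_lt (x := x) (by simp)
  have h3 : Fintype.card {v : V | v ≠ x} = Fintype.card {v : V // v ≠ x} :=
    Fintype.card_congr (Equiv.refl _)
  omega

/-- cross product -/
def cr (P Q X : ℝ × ℝ) : ℝ := (Q.1 - P.1) * (X.2 - P.2) - (Q.2 - P.2) * (X.1 - P.1)

/-- the drawing condition -/
def Good {V : Type} (G : SimpleGraph V) (pos : V → ℝ × ℝ) : Prop :=
  Function.Injective pos ∧
    ∀ u v x y : V, G.Adj u v → G.Adj x y → s(u, v) ≠ s(x, y) →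
      ∀ p : ℝ × ℝ, p ∈ segment ℝ (pos u) (pos v) → p ∈ segment ℝ (pos x) (pos y) →
        (p = pos u ∨ p = pos v) ∧ (p = pos x ∨ p = pos y)

/-- vertices are not on other edges -/
theorem Good.notMem {V : Type} {G : SimpleGraph V} {pos : V → ℝ × ℝ} (h : Good G pos)
    {v w x y : V} (hvw : G.Adj v w) (hxy : G.Adj x y) (hx : v ≠ x) (hy : v ≠ y) :
    pos v ∉ segment ℝ (pos x) (pos y) := by
  intro hm
  have hne : s(v, w) ≠ s(x, y) := by
    intro he
    rw [Sym2.eq_iff] at he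
    rcases he with he | he
    · exact hx he.1
    · exact hy he.1
  rcases (h.2 v w x y hvw hxy hne _ (left_mem_segment ℝ _ _) hm).2 with h' | h'
  · exact hx (h.1 h')
  · exact hy (h.1 h')

theorem Good.disjoint {V : Type} {G : SimpleGraph V} {pos : V → ℝ × ℝ} (h : Good G pos)
    {v w x y : V} (hvw : G.Adj v w) (hxy : G.Adj x y) (h1 : v ≠ x) (h2 : v ≠ y)
    {p : ℝ × ℝ} (hp : p ∈ segment ℝ (pos v) (pos w)) (hpw : p ≠ pos w) :
    p ∉ segment ℝ (pos x) (pos y) := by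
  intro hm
  have hne : s(v, w) ≠ s(x, y) := by
    intro he
    rw [Sym2.eq_iff] at he
    rcases he with he | he
    · exact h1 he.1
    · exact h2 he.1
  rcases h.2 v w x y hvw hxy hne _ hp hm with ⟨h3, h4⟩
  rcases h3 with h3 | h3
  · rcases h4 with h4 | h4
    · exact h1 (h.1 (h3.symm.trans h4))
    · exact h2 (h.1 (h3.symm.trans h4))
  · exact hpw h3

theorem collinear_aux {A B C : ℝ × ℝ} (hAB : A ≠ B) (h : cr A B C = 0) :
    ∃ t : ℝ, C = A + t • (B - A) := by
  obtain ⟨a1, a2⟩ := A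
  obtain ⟨b1, b2⟩ := B
  obtain ⟨c1, c2⟩ := C
  simp only [cr] at h
  by_cases h1 : b1 - a1 = 0
  · have h2 : b2 - a2 ≠ 0 := by
      intro h2
      apply hAB
      ext
      · simp; linarith
      · simp; linarith
    refine ⟨(c2 - a2) / (b2 - a2), ?_⟩
    ext
    · simp
      field_simp
      linarith
    · simp
      field_simp
      ring
  · refine ⟨(c1 - a1) / (b1 - a1), ?_⟩
    ext
    · simp
      field_simp
      ring
    · simp
      field_simp
      linarith

theorem Good.cr_ne {V : Type} {G : SimpleGraph V} {pos : V → ℝ × ℝ} (h : Good G pos)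
    {a b c : V} (hab : G.Adj a b) (hbc : G.Adj b c) (hac : G.Adj a c) :
    cr (pos a) (pos b) (pos c) ≠ 0 := by
  intro h0
  obtain ⟨t, ht⟩ := collinear_aux (fun he => hab.ne (h.1 he)) h0
  rcases lt_or_ge t 0 with h1 | h1
  · refine h.notMem hab hbc hab.ne hac.ne ⟨-t / (1 - t), 1 / (1 - t), ?_, ?_, ?_, ?_⟩
    · exact div_nonneg (by linarith) (by linarith)
    · exact div_nonneg (by linarith) (by linarith)
    · have : 1 - t ≠ 0 := by linarith
      field_simp; ring
    · have : 1 - t ≠ 0 := by linarith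
      rw [ht]
      ext <;> simp <;> field_simp <;> ring
  rcases le_or_gt t 1 with h2 | h2
  · refine h.notMem hbc.symm hab hac.ne' hbc.ne' ⟨1 - t, t, by linarith, h1, by ring, ?_⟩
    rw [ht]
    ext <;> simp <;> ring
  · refine h.notMem hab.symm hac hab.ne' hbc.ne ⟨1 - 1 / t, 1 / t, ?_, by positivity, by ring, ?_⟩
    · have : 1 / t ≤ 1 := by rw [div_le_one (by linarith)]; linarith
      linarith
    · have : t ≠ 0 := by linarith
      rw [ht]
      ext <;> simp <;> field_simp <;> ring

theorem coords {A B C D : ℝ × ℝ} {α β γ : ℝ} (hα : 0 < α) (hβ : 0 < β) (hγ : 0 < γ)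
    (hs : α + β + γ = 1) (hD : D = α • A + β • B + γ • C) (hcr : cr A B C ≠ 0) :
    ∃ f g h : ℝ × ℝ → ℝ, Continuous f ∧ Continuous g ∧ Continuous h ∧
      (∀ X, X = (f X * α) • A + (g X * β) • B + (h X * γ) • C) ∧
      (∀ X, f X * α + g X * β + h X * γ = 1) ∧
      (0 < f A ∧ g A = 0 ∧ h A = 0) ∧ (f B = 0 ∧ 0 < g B ∧ h B = 0) ∧
      (f C = 0 ∧ g C = 0 ∧ 0 < h C) ∧ (f D = 1 ∧ g D = 1 ∧ h D = 1) := by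
  have hγ' : γ = 1 - α - β := by linarith
  have e1 : cr B C A = cr A B C := by simp only [cr]; ring
  have e2 : cr C A B = cr A B C := by simp only [cr]; ring
  have z1 : ∀ P Q : ℝ × ℝ, cr P Q P = 0 := by intro P Q; simp only [cr]; ring
  have z2 : ∀ P Q : ℝ × ℝ, cr P Q Q = 0 := by intro P Q; simp only [cr]; ring
  refine ⟨fun X => cr B C X / cr A B C / α, fun X => cr C A X / cr A B C / β,
    fun X => cr A B X / cr A B C / γ, ?_, ?_, ?_, ?_, ?_, ?_, ?_, ?_, ?_⟩
  · unfold cr; fun_prop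
  · unfold cr; fun_prop
  · unfold cr; fun_prop
  · intro X
    simp only [div_mul_cancel₀ _ hα.ne', div_mul_cancel₀ _ hβ.ne', div_mul_cancel₀ _ hγ.ne']
    ext
    · simp only [Prod.fst_add, Prod.smul_fst, smul_eq_mul]
      field_simp
      simp only [cr]; ring
    · simp only [Prod.snd_add, Prod.smul_snd, smul_eq_mul]
      field_simp
      simp only [cr]; ring
  · intro X
    simp only [div_mul_cancel₀ _ hα.ne', div_mul_cancel₀ _ hβ.ne', div_mul_cancel₀ _ hγ.ne']
    field_simp
    simp only [cr]; ring
  · simp [e1, z1, z2, hcr, hα]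
  · simp [e2, z1, z2, hcr, hβ]
  · simp [z1, z2, hcr, hγ]
  · have d1 : cr B C D = α * cr A B C := by
      simp [cr, hD, hγ']; ring
    have d2 : cr C A D = β * cr A B C := by
      simp [cr, hD, hγ']; ring
    have d3 : cr A B D = γ * cr A B C := by
      simp [cr, hD, hγ']; ring
    simp only [d1, d2, d3]
    refine ⟨?_, ?_, ?_⟩ <;> field_simp

theorem regions {A B C D : ℝ × ℝ} {α β γ : ℝ} (hα : 0 < α) (hβ : 0 < β) (hγ : 0 < γ)
    (hs : α + β + γ = 1) (hD : D = α • A + β • B + γ • C) (hcr : cr A B C ≠ 0) :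
    ∃ R : Fin 4 → Set (ℝ × ℝ), (∀ i, IsOpen (R i)) ∧ (∀ i j, i ≠ j → Disjoint (R i) (R j)) ∧
      (∀ X, X ∉ segment ℝ A B → X ∉ segment ℝ B C → X ∉ segment ℝ C A → X ∉ segment ℝ A D →
        X ∉ segment ℝ B D → X ∉ segment ℝ C D → ∃ i, X ∈ R i) ∧
      A ∉ closure (R 0) ∧ B ∉ closure (R 1) ∧ C ∉ closure (R 2) ∧ D ∉ closure (R 3) := by
  obtain ⟨f, g, h, cf, cg, ch, hX, h1, hA, hB, hC, hD'⟩ := coords hα hβ hγ hs hD hcr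
  refine ⟨![{X | 0 < f X ∧ f X < g X ∧ f X < h X}, {X | 0 < g X ∧ g X < f X ∧ g X < h X},
    {X | 0 < h X ∧ h X < f X ∧ h X < g X}, {X | f X < 0 ∨ g X < 0 ∨ h X < 0}], ?_, ?_, ?_,
    ?_, ?_, ?_, ?_⟩
  · intro i
    have o : ∀ u v : ℝ × ℝ → ℝ, Continuous u → Continuous v → IsOpen {X | u X < v X} :=
      fun u v hu hv => isOpen_lt hu hv
    fin_cases i
    · exact (o _ _ continuous_const cf).inter ((o _ _ cf cg).inter (o _ _ cf ch))
    · exact (o _ _ continuous_const cg).inter ((o _ _ cg cf).inter (o _ _ cg ch))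
    · exact (o _ _ continuous_const ch).inter ((o _ _ ch cf).inter (o _ _ ch cg))
    · exact (o _ _ cf continuous_const).union ((o _ _ cg continuous_const).union
        (o _ _ ch continuous_const))
  · intro i j hij
    rw [Set.disjoint_left]
    intro X
    fin_cases i <;> fin_cases j <;> simp at hij ⊢ <;> intros <;>
      first
      | (refine ⟨?_, ?_, ?_⟩ <;> linarith)
      | linarith
      | grind
  · intro X nAB nBC nCA nAD nBD nCD
    by_contra hcon
    push Not at hcon
    have k0 := hcon 0
    have k1 := hcon 1
    have k2 := hcon 2
    have k3 := hcon 3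
    simp only [Matrix.cons_val, Set.mem_ofPred_eq] at k0 k1 k2 k3
    push Not at k3
    obtain ⟨hf, hg, hh⟩ := k3
    have hx := hX X
    have hx1 := h1 X
    generalize f X = x at *
    generalize g X = y at *
    generalize h X = z at *
    have px : x ≠ 0 := by
      rintro rfl
      exact nBC ⟨y * β, z * γ, by positivity, by positivity, by linarith, by rw [hx]; simp⟩
    have py : y ≠ 0 := by
      rintro rfl
      exact nCA ⟨z * γ, x * α, by positivity, by positivity, by linarith, by
        rw [hx]; simp [add_comm]⟩
    have pz : z ≠ 0 := by
      rintro rfl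
      exact nAB ⟨x * α, y * β, by positivity, by positivity, by linarith, by rw [hx]; simp⟩
    have tA : y = z → ¬ (y ≤ x) := by
      rintro rfl hle
      refine nAD ⟨(x - y) * α, y, mul_nonneg (by linarith) hα.le, hg, by nlinarith, ?_⟩
      rw [hx, hD]
      module
    have tB : x = z → ¬ (x ≤ y) := by
      rintro rfl hle
      refine nBD ⟨(y - x) * β, x, mul_nonneg (by linarith) hβ.le, hf, by nlinarith, ?_⟩
      rw [hx, hD]
      module
    have tC : x = y → ¬ (x ≤ z) := by
      rintro rfl hle
      refine nCD ⟨(z - x) * γ, x, mul_nonneg (by linarith) hγ.le, hf, by nlinarith, ?_⟩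
      rw [hx, hD]
      module
    have qx := lt_of_le_of_ne hf px.symm
    have qy := lt_of_le_of_ne hg py.symm
    have qz := lt_of_le_of_ne hh pz.symm
    rcases lt_trichotomy x y with u | u | u
    · rcases lt_trichotomy x z with w | w | w
      · exact k0 ⟨qx, u, w⟩
      · exact tB w u.le
      · exact k2 ⟨qz, w, w.trans u⟩
    · rcases le_or_gt x z with w | w
      · exact tC u w
      · exact k2 ⟨qz, w, u ▸ w⟩
    · rcases lt_trichotomy y z with w | w | w
      · exact k1 ⟨qy, u, w⟩
      · exact tA w u.le
      · exact k2 ⟨qz, w.trans u, w⟩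
  · intro hm
    have : A ∈ {X | f X ≤ g X} := closure_minimal (fun X hX => by exact hX.2.1.le)
      (isClosed_le cf cg) hm
    simp only [Set.mem_ofPred_eq] at this
    linarith [hA.1, hA.2.1]
  · intro hm
    have : B ∈ {X | g X ≤ f X} := closure_minimal (fun X hX => by exact hX.2.1.le)
      (isClosed_le cg cf) hm
    simp only [Set.mem_ofPred_eq] at this
    linarith [hB.1, hB.2.1]
  · intro hm
    have : C ∈ {X | h X ≤ f X} := closure_minimal (fun X hX => by exact hX.2.1.le)
      (isClosed_le ch cf) hm
    simp only [Set.mem_ofPred_eq] at this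
    linarith [hC.1, hC.2.2]
  · intro hm
    have : D ∈ {X | f X ≤ 0} ∪ ({X | g X ≤ 0} ∪ {X | h X ≤ 0}) := closure_minimal
      (fun X hX => by
        rcases hX with hX | hX | hX
        · exact Or.inl (le_of_lt hX)
        · exact Or.inr (Or.inl (le_of_lt hX))
        · exact Or.inr (Or.inr (le_of_lt hX)))
      ((isClosed_le cf continuous_const).union ((isClosed_le cg continuous_const).union
        (isClosed_le ch continuous_const))) hm
    simp only [Set.mem_union, Set.mem_ofPred_eq] at this
    rw [hD'.1, hD'.2.1, hD'.2.2] at this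
    norm_num at this

theorem core {V : Type} (G : SimpleGraph V)
    (hsub : ∀ x : V, (G.induce {v | v ≠ x}).Colorable 4) {pos : V → ℝ × ℝ} (hg : Good G pos)
    (a b c d : V) (hab : G.Adj a b) (hac : G.Adj a c) (had : G.Adj a d) (hbc : G.Adj b c)
    (hbd : G.Adj b d) (hcd : G.Adj c d) {α β γ : ℝ} (hα : 0 < α) (hβ : 0 < β) (hγ : 0 < γ)
    (hs : α + β + γ = 1) (hD : pos d = α • pos a + β • pos b + γ • pos c) : G.Colorable 4 := by
  classical
  obtain ⟨R, ho, hdis, hcov, cA, cB, cC, cD⟩ := regions hα hβ hγ hs hD (hg.cr_ne hab hbc hac)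
  let K : Fin 4 → V := ![a, b, c, d]
  have hcl : ∀ j, pos (K j) ∉ closure (R j) := by
    intro j
    fin_cases j
    · exact cA
    · exact cB
    · exact cC
    · exact cD
  have hK : ∀ i j, i ≠ j → G.Adj (K i) (K j) := by
    intro i j hij
    fin_cases i <;> fin_cases j <;> simp [K] at hij ⊢ <;>
      first | assumption | (apply SimpleGraph.Adj.symm; assumption)
  have cov : ∀ v w p, (∀ j, v ≠ K j) → G.Adj v w → p ∈ segment ℝ (pos v) (pos w) →
      p ≠ pos w → ∃ i, p ∈ R i := by
    intro v w p hv hvw hp hpw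
    have va : v ≠ a := hv 0
    have vb : v ≠ b := hv 1
    have vc : v ≠ c := hv 2
    have vd : v ≠ d := hv 3
    apply hcov
    · exact hg.disjoint hvw hab va vb hp hpw
    · exact hg.disjoint hvw hbc vb vc hp hpw
    · exact hg.disjoint hvw hac.symm vc va hp hpw
    · exact hg.disjoint hvw had va vd hp hpw
    · exact hg.disjoint hvw hbd vb vd hp hpw
    · exact hg.disjoint hvw hcd vc vd hp hpw
  have conn : ∀ v w i, (∀ j, v ≠ K j) → G.Adj v w → pos v ∈ R i → pos w ∈ closure (R i) := by
    intro v w i hv hvw hvi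
    let φ : ℝ → ℝ × ℝ := fun t => AffineMap.lineMap (pos v) (pos w) t
    have hφ : Continuous φ := AffineMap.lineMap_continuous
    have hpre : IsPreconnected (φ '' Set.Ico 0 1) := isPreconnected_Ico.image _ hφ.continuousOn
    have hsubR : φ '' Set.Ico 0 1 ⊆ R i := by
      refine hpre.subset_left_of_subset_union (ho i)
        (isOpen_biUnion (s := {j | j ≠ i}) (f := R) fun j _ => ho j) ?_ ?_ ?_
      · rw [Set.disjoint_iUnion₂_right]
        intro j hj
        exact hdis i j (Ne.symm hj)
      · rintro p ⟨t, ht, rfl⟩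
        obtain ⟨j, hj⟩ := cov v w (φ t) hv hvw (by
            rw [segment_eq_image_lineMap]
            exact ⟨t, ⟨ht.1, ht.2.le⟩, rfl⟩) (by
            intro he
            have hpw : φ 1 = pos w := AffineMap.lineMap_apply_one _ _
            have := AffineMap.lineMap_injective ℝ (fun he => hvw.ne (hg.1 he)) (he.trans hpw.symm)
            exact ht.2.ne this)
        by_cases hji : j = i
        · left; rw [← hji]; exact hj
        · right
          exact Set.mem_biUnion (show j ∈ {j | j ≠ i} from hji) hj
      · exact ⟨pos v, ⟨0, by simp, AffineMap.lineMap_apply_zero _ _⟩, hvi⟩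
    apply closure_mono hsubR
    apply image_closure_subset_closure_image hφ
    refine ⟨1, ?_, AffineMap.lineMap_apply_one _ _⟩
    rw [closure_Ico (by norm_num)]
    simp
  let r : V → Fin 4 := fun v => if h : ∃ i, pos v ∈ R i then h.choose else 0
  have hr : ∀ v w, (∀ j, v ≠ K j) → G.Adj v w → pos v ∈ R (r v) := by
    intro v w hv hvw
    have h := cov v w (pos v) hv hvw (left_mem_segment ℝ _ _) (fun he => hvw.ne (hg.1 he))
    simp only [r, dif_pos h]
    exact h.choose_spec
  refine combine_aux G hsub K hK r ?_ ?_
  · intro v w hv hw hvw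
    have m1 := conn v w _ hv hvw (hr v w hv hvw)
    have m2 := hr w v hw hvw.symm
    by_contra hne
    have := (hdis _ _ hne).closure_left (ho _)
    exact Set.disjoint_left.mp this m1 m2
  · intro v j hv hvj hrj
    have m1 := conn v _ _ hv hvj (hr v _ hv hvj)
    rw [hrj] at m1
    exact hcl j m1

theorem Good.no_cross {V : Type} {G : SimpleGraph V} {pos : V → ℝ × ℝ} (h : Good G pos)
    {a b c d : V} (hab : G.Adj a b) (hcd : G.Adj c d) (hac : a ≠ c) (had : a ≠ d)
    (hbc : b ≠ c) (hbd : b ≠ d) {p q r s : ℝ} (hp : 0 < p) (hq : 0 < q) (hr : r < 0) (hs : s < 0)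
    (h0 : p + q + r + s = 0) (h1 : p • pos a + q • pos b + r • pos c + s • pos d = 0) : False := by
  have hpq : 0 < p + q := by linarith
  let X := (p / (p + q)) • pos a + (q / (p + q)) • pos b
  have m1 : X ∈ segment ℝ (pos a) (pos b) :=
    ⟨p / (p + q), q / (p + q), by positivity, by positivity, by field_simp, rfl⟩
  have m2 : X ∈ segment ℝ (pos c) (pos d) := by
    refine ⟨-r / (p + q), -s / (p + q), div_nonneg (by linarith) hpq.le,
      div_nonneg (by linarith) hpq.le, ?_, ?_⟩
    · field_simp; linarith
    · have e : p • pos a + q • pos b = (-r) • pos c + (-s) • pos d := by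
        rw [← sub_eq_zero, ← h1]; module
      have e2 := congrArg (fun Y => (1 / (p + q)) • Y) e
      simp only [smul_add, smul_smul] at e2
      simp only [X]
      rw [div_eq_mul_one_div p, div_eq_mul_one_div q, div_eq_mul_one_div (-r),
        div_eq_mul_one_div (-s), mul_comm p, mul_comm q, mul_comm (-r), mul_comm (-s)]
      exact e2.symm
  by_cases hx : X = pos b
  · rw [hx] at m2
    exact h.notMem hab.symm hcd hbc hbd m2
  · exact h.disjoint hab hcd hac had m1 hx m2

theorem core' {V : Type} (G : SimpleGraph V)
    (hsub : ∀ x : V, (G.induce {v | v ≠ x}).Colorable 4) {pos : V → ℝ × ℝ} (hg : Good G pos)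
    (a b c d : V) (hab : G.Adj a b) (hac : G.Adj a c) (had : G.Adj a d) (hbc : G.Adj b c)
    (hbd : G.Adj b d) (hcd : G.Adj c d) {p q r s : ℝ} (hp : p < 0) (hq : q < 0) (hr : r < 0)
    (h0 : p + q + r + s = 0) (h1 : p • pos a + q • pos b + r • pos c + s • pos d = 0) :
    G.Colorable 4 := by
  have hs : 0 < s := by linarith
  refine core G hsub hg a b c d hab hac had hbc hbd hcd (α := -p / s) (β := -q / s)
    (γ := -r / s) (div_pos (by linarith) hs) (div_pos (by linarith) hs)
    (div_pos (by linarith) hs) (by field_simp; linarith) ?_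
  have e : s • pos d = (-p) • pos a + (-q) • pos b + (-r) • pos c := by
    rw [← sub_eq_zero, ← h1]; module
  have e2 := congrArg (fun Y => s⁻¹ • Y) e
  simp only [smul_add, smul_smul, inv_mul_cancel₀ hs.ne', one_smul] at e2
  rw [e2]
  simp only [div_eq_inv_mul]

theorem signs {V : Type} (G : SimpleGraph V)
    (hsub : ∀ x : V, (G.induce {v | v ≠ x}).Colorable 4) {pos : V → ℝ × ℝ} (hg : Good G pos)
    (a b c d : V) (hab : G.Adj a b) (hac : G.Adj a c) (had : G.Adj a d) (hbc : G.Adj b c)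
    (hbd : G.Adj b d) (hcd : G.Adj c d) {p q r s : ℝ} (hp : p ≠ 0) (hq : q ≠ 0) (hr : r ≠ 0)
    (hs : s < 0)
    (h0 : p + q + r + s = 0) (h1 : p • pos a + q • pos b + r • pos c + s • pos d = 0) :
    G.Colorable 4 := by
  rcases lt_or_gt_of_ne hp with hp | hp <;> rcases lt_or_gt_of_ne hq with hq | hq <;>
    rcases lt_or_gt_of_ne hr with hr | hr
  · linarith
  · exact core' G hsub hg a b d c hab had hac hbd hbc hcd.symm hp hq hs (s := r) (by linarith)
      (by rw [← h1]; module)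
  · exact core' G hsub hg a c d b hac had hab hcd hbc.symm hbd.symm hp hr hs (s := q) (by linarith)
      (by rw [← h1]; module)
  · exact (hg.no_cross hbc had hab.ne' hbd.ne hac.ne' hcd.ne hq hr hp hs (by linarith)
      (by rw [← h1]; module)).elim
  · exact core' G hsub hg b c d a hbc hbd hab.symm hcd hac.symm had.symm hq hr hs (s := p)
      (by linarith) (by rw [← h1]; module)
  · exact (hg.no_cross hac hbd hab.ne had.ne hbc.ne' hcd.ne hp hr hq hs (by linarith)
      (by rw [← h1]; module)).elim
  · exact (hg.no_cross hab hcd hac.ne had.ne hbc.ne hbd.ne hp hq hr hs (by linarith)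
      (by rw [← h1])).elim
  · refine core G hsub hg a b c d hab hac had hbc hbd hcd (α := p / (-s)) (β := q / (-s))
      (γ := r / (-s)) (div_pos hp (by linarith)) (div_pos hq (by linarith))
      (div_pos hr (by linarith)) (by
        rw [← add_div, ← add_div, div_eq_one_iff_eq (by linarith)]; linarith) ?_
    have e : (-s) • pos d = p • pos a + q • pos b + r • pos c := by
      symm; rw [← sub_eq_zero, ← h1]; module
    have hs' : -s ≠ 0 := by linarith
    have e2 := congrArg (fun Y => (-s)⁻¹ • Y) e
    simp only [smul_add, smul_smul, inv_mul_cancel₀ hs', one_smul] at e2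
    rw [e2]
    simp only [div_eq_inv_mul]

theorem k4_colorable {V : Type} (G : SimpleGraph V)
    (hsub : ∀ x : V, (G.induce {v | v ≠ x}).Colorable 4) {pos : V → ℝ × ℝ} (hg : Good G pos)
    (a b c d : V) (hab : G.Adj a b) (hac : G.Adj a c) (had : G.Adj a d) (hbc : G.Adj b c)
    (hbd : G.Adj b d) (hcd : G.Adj c d) : G.Colorable 4 := by
  have n1 := hg.cr_ne hbc hcd hbd
  have n2 := hg.cr_ne hac hcd had
  have n3 := hg.cr_ne hab hbd had
  have n4 := hg.cr_ne hab hbc hac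
  have s0 : cr (pos b) (pos c) (pos d) + -cr (pos a) (pos c) (pos d) +
      cr (pos a) (pos b) (pos d) + -cr (pos a) (pos b) (pos c) = 0 := by
    simp only [cr]; ring
  have s1 : cr (pos b) (pos c) (pos d) • pos a + (-cr (pos a) (pos c) (pos d)) • pos b +
      cr (pos a) (pos b) (pos d) • pos c + (-cr (pos a) (pos b) (pos c)) • pos d = 0 := by
    ext
    · simp [cr]; ring
    · simp [cr]; ring
  rcases lt_or_gt_of_ne n4 with h | h
  · exact signs G hsub hg a b c d hab hac had hbc hbd hcd (neg_ne_zero.mpr n1) n2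
      (neg_ne_zero.mpr n3) h (by linarith) (by rw [← neg_eq_zero, ← s1]; module)
  · exact signs G hsub hg a b c d hab hac had hbc hbd hcd n1 (neg_ne_zero.mpr n2)
      n3 (by linarith) s0 s1

/-- In a minimum-order non-4-colorable maximal planar graph with more than 4
vertices, the two opposite vertices `N`, `S` of the `e`-diamond around any edge
`e = ab` are not adjacent. -/
theorem stmt_13 {V : Type} [Fintype V] (EP : SimpleGraph V)
    (hEP : IsMinCounterexample EP) (hn : 4 < Fintype.card V)
    (a b N S : V) (hab : EP.Adj a b)
    (hNS : N ≠ S)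
    (hN : EP.Adj a N ∧ EP.Adj b N) (hS : EP.Adj a S ∧ EP.Adj b S)
    (htwo : ∀ w : V, EP.Adj a w → EP.Adj b w → w = N ∨ w = S) :
    ¬ EP.Adj N S := by
  intro h
  obtain ⟨pos, hg⟩ := hEP.1.1
  exact hEP.2.1 (k4_colorable EP (sub_colorable EP hEP) (pos := pos) hg a b N S hab hN.1 hS.1
    hN.2 hS.2 h)
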